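/- Let ν ∈ ℝ and fix β₁ > v > −ν. For −ν < β₃ < β₂ < β₁ let s² := (β₁+ν)(β₂−β₃)/((β₂+ν)(β₁−β₃)), ρ := (β₂−β₃)/(β₂+ν), and define the first characteristic speed of the Camassa–Holm–Whitham system C₁(β₁,β₂,β₃) := β₁+β₂+β₃+2ν + 2(β₃+ν)(β₁−β₂)Λ(s,ρ)/((β₂+ν)E(s)). Then C₁(β₁, v+δ, v−δ) → 3β₁ + 2ν as δ → 0⁺; that is, at the coalescence β₂ = β₃ the Whitham equation for β₁ reduces to the Hopf equation ∂_t u + (3u+2ν)∂_x u = 0. -/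

import Mathlib

open Real intervalIntegral Filter Topology

/-- Complete elliptic integral of the first kind. -/
noncomputable def ellK (s : ℝ) : ℝ :=
  ∫ z in (0:ℝ)..1, 1 / Real.sqrt ((1 - z ^ 2) * (1 - s ^ 2 * z ^ 2))

/-- Complete elliptic integral of the second kind. -/
noncomputable def ellE (s : ℝ) : ℝ :=
  ∫ z in (0:ℝ)..1, Real.sqrt (1 - s ^ 2 * z ^ 2) / Real.sqrt (1 - z ^ 2)

/-- Complete elliptic integral of the third kind. -/
noncomputable def ellΛ (s ρ : ℝ) : ℝ :=
  ∫ z in (0:ℝ)..1,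
    1 / ((1 - ρ * z ^ 2) * Real.sqrt ((1 - z ^ 2) * (1 - s ^ 2 * z ^ 2)))

/-- First characteristic speed of the Camassa–Holm–Whitham system. -/
noncomputable def whithamC₁ (ν β₁ β₂ β₃ : ℝ) : ℝ :=
  let s : ℝ := Real.sqrt ((β₁ + ν) * (β₂ - β₃) / ((β₂ + ν) * (β₁ - β₃)))
  let ρ : ℝ := (β₂ - β₃) / (β₂ + ν)
  β₁ + β₂ + β₃ + 2 * ν
    + 2 * (β₃ + ν) * (β₁ - β₂) * ellΛ s ρ / ((β₂ + ν) * ellE s)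

lemma intervalIntegrable_inv_sqrt_one_sub_sq :
    IntervalIntegrable (fun z : ℝ => (√(1 - z ^ 2))⁻¹) MeasureTheory.volume 0 1 := by
  refine intervalIntegrable_deriv_of_nonneg (g := arcsin) continuous_arcsin.continuousOn ?_ ?_
  · intro z hz
    simp only [zero_le_one, min_eq_left, max_eq_right, Set.mem_Ioo] at hz
    simpa using hasDerivAt_arcsin (by linarith [hz.1] : -1 < z).ne' hz.2.ne
  · intro z _
    positivity

lemma integral_inv_sqrt_one_sub_sq_pos : 0 < ∫ z in (0 : ℝ)..1, (√(1 - z ^ 2))⁻¹ := by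
  refine intervalIntegral_pos_of_pos_on intervalIntegrable_inv_sqrt_one_sub_sq ?_ one_pos
  intro z hz
  have : 0 < 1 - z ^ 2 := by nlinarith [hz.1, hz.2]
  positivity

lemma tendsto_ellE_zero :
    Tendsto ellE (𝓝 0) (𝓝 (∫ z in (0 : ℝ)..1, (√(1 - z ^ 2))⁻¹)) := by
  refine tendsto_integral_filter_of_dominated_convergence (fun z => (√(1 - z ^ 2))⁻¹)
    (Eventually.of_forall fun s => ?_) (Eventually.of_forall fun s => ?_)
    intervalIntegrable_inv_sqrt_one_sub_sq (Eventually.of_forall fun z _ => ?_)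
  · exact (by fun_prop : Measurable fun z : ℝ => √(1 - s ^ 2 * z ^ 2) / √(1 - z ^ 2))
      |>.aestronglyMeasurable
  · refine Eventually.of_forall fun z _ => ?_
    rw [norm_of_nonneg (by positivity), ← one_div]
    gcongr
    exact Real.sqrt_le_one.mpr (by nlinarith [sq_nonneg (s * z)])
  · have h : Tendsto (fun s : ℝ => √(1 - s ^ 2 * z ^ 2) / √(1 - z ^ 2)) (𝓝 0)
        (𝓝 (√(1 - 0 ^ 2 * z ^ 2) / √(1 - z ^ 2))) :=
      Continuous.tendsto (by fun_prop) 0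
    simpa using h

lemma tendsto_ellΛ_zero :
    Tendsto (fun p : ℝ × ℝ => ellΛ p.1 p.2) (𝓝 (0, 0))
      (𝓝 (∫ z in (0 : ℝ)..1, (√(1 - z ^ 2))⁻¹)) := by
  refine tendsto_integral_filter_of_dominated_convergence (fun z => 4 * (√(1 - z ^ 2))⁻¹)
    (Eventually.of_forall fun p => ?_) ?_
    (intervalIntegrable_inv_sqrt_one_sub_sq.const_mul 4) (Eventually.of_forall fun z hz => ?_)
  · exact (by fun_prop : Measurable fun z : ℝ =>
      1 / ((1 - p.2 * z ^ 2) * √((1 - z ^ 2) * (1 - p.1 ^ 2 * z ^ 2)))) |>.aestronglyMeasurable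
  · have hs : ∀ᶠ p : ℝ × ℝ in 𝓝 (0, 0), p.1 ^ 2 < 1 / 2 :=
      (Continuous.tendsto (by fun_prop : Continuous fun p : ℝ × ℝ => p.1 ^ 2)
        (0, 0)).eventually_lt_const (by norm_num)
    have hρ : ∀ᶠ p : ℝ × ℝ in 𝓝 (0, 0), p.2 < 1 / 2 :=
      continuous_snd.continuousAt.eventually_lt_const (by norm_num)
    filter_upwards [hs, hρ] with p hs hρ
    refine Eventually.of_forall fun z hz => ?_
    rw [Set.uIoc_of_le zero_le_one] at hz
    have hz0 : 0 ≤ 1 - z ^ 2 := by nlinarith [hz.1, hz.2]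
    have h₁ : 1 / 2 ≤ 1 - p.2 * z ^ 2 := by nlinarith [sq_nonneg z]
    have h₂ : 1 / 2 ≤ √(1 - p.1 ^ 2 * z ^ 2) :=
      Real.le_sqrt_of_sq_le (by nlinarith [sq_nonneg z, sq_nonneg p.1])
    have h₃ : 1 / 4 ≤ (1 - p.2 * z ^ 2) * √(1 - p.1 ^ 2 * z ^ 2) := by nlinarith
    rw [Real.sqrt_mul hz0, mul_left_comm, one_div, mul_inv, mul_comm,
      norm_of_nonneg (by positivity)]
    gcongr
    exact inv_le_of_inv_le₀ (by norm_num) (by linarith)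
  · rcases eq_or_ne (√(1 - z ^ 2)) 0 with h0 | h0
    · rw [Set.uIoc_of_le zero_le_one] at hz
      have hz1 : 1 - z ^ 2 = 0 :=
        (Real.sqrt_eq_zero (by nlinarith [hz.1, hz.2])).mp h0
      simp [hz1]
    · have h : ContinuousAt (fun p : ℝ × ℝ =>
          1 / ((1 - p.2 * z ^ 2) * √((1 - z ^ 2) * (1 - p.1 ^ 2 * z ^ 2)))) (0, 0) := by
        refine ContinuousAt.div (by fun_prop) (by fun_prop) ?_
        simpa using h0
      simpa [ContinuousAt] using h

/-- at the coalescence `β₂ = β₃ = v` the first Whitham speed tends to the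
Hopf characteristic speed `3β₁ + 2ν`. -/
theorem whithamC₁_tendsto_hopf_speed
    (ν β₁ v : ℝ) (hv : -ν < v) (hβ₁ : v < β₁) :
    Tendsto (fun δ : ℝ => whithamC₁ ν β₁ (v + δ) (v - δ))
      (𝓝[>] 0) (𝓝 (3 * β₁ + 2 * ν)) := by
  have hν : v + ν ≠ 0 := (by linarith : 0 < v + ν).ne'
  have hβ : β₁ - v ≠ 0 := (sub_pos.mpr hβ₁).ne'
  have hJ := integral_inv_sqrt_one_sub_sq_pos.ne'
  set s : ℝ → ℝ := fun δ =>
    √((β₁ + ν) * ((v + δ) - (v - δ)) / ((v + δ + ν) * (β₁ - (v - δ)))) with hs_def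
  set ρ : ℝ → ℝ := fun δ => ((v + δ) - (v - δ)) / (v + δ + ν) with hρ_def
  have hs : Tendsto s (𝓝 0) (𝓝 0) := by
    have h : ContinuousAt s 0 :=
      (ContinuousAt.div (by fun_prop) (by fun_prop) (by simp [hν, hβ])).sqrt
    simpa [ContinuousAt, hs_def] using h
  have hρ : Tendsto ρ (𝓝 0) (𝓝 0) := by
    have h : ContinuousAt ρ 0 := ContinuousAt.div (by fun_prop) (by fun_prop) (by simpa using hν)
    simpa [ContinuousAt, hρ_def] using h
  have hE := tendsto_ellE_zero.comp hs
  have hΛ := tendsto_ellΛ_zero.comp (hs.prodMk_nhds hρ)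
  generalize (∫ z in (0 : ℝ)..1, (√(1 - z ^ 2))⁻¹) = J at hJ hE hΛ
  have hδ : Tendsto (fun δ : ℝ => δ) (𝓝 0) (𝓝 0) := tendsto_id
  have hβ₂ := hδ.const_add v
  have hβ₃ := hδ.const_sub v
  have h := ((((hβ₂.const_add β₁).add hβ₃).add_const (2 * ν))).add
    (((((hβ₃.add_const ν).const_mul 2).mul (hβ₂.const_sub β₁)).mul hΛ).div
      ((hβ₂.add_const ν).mul hE) (by simp [hν, hJ]))
  refine Tendsto.mono_left ?_ nhdsWithin_le_nhds
  convert h using 2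
  · rfl
  · simp only [add_zero, sub_zero]
    field_simp
    ring
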